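/- Let n ≥ 1 and let ∗ be a bilinear multiplication making A = (Fin n → ℝ) a left-symmetric algebra with characteristic polynomial P(x) = det(id_A + R(x)) and trace form τ. Suppose there are a nonzero vector v ∈ A and λ ∈ ℝ such that P(x + t·v) = P(x) + λ·t for all x ∈ A and t ∈ ℝ, and suppose 2·tr L(x) = (n+1)·tr R(x) for all x ∈ A. Then there is a constant κ ∈ ℝ with H(e^P)(x) = κ·e^{n·P(x)} for all x ∈ A. If moreover τ is nondegenerate, then κ ≠ 0, λ ≠ 0, and r := λ⁻¹·v satisfies τ(r, x) = tr R(x) for all x ∈ A, r∗r = r, and tr R(r) = 1. -/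

import Mathlib

noncomputable def hessianDet {m : ℕ} (F : (Fin m → ℝ) → ℝ) (x : Fin m → ℝ) : ℝ :=
  (Matrix.of fun i j : Fin m =>
    fderiv ℝ (fun y => fderiv ℝ F y (Pi.single j 1)) x (Pi.single i 1)).det

def IsLSA {n : ℕ} (mul : (Fin n → ℝ) →ₗ[ℝ] (Fin n → ℝ) →ₗ[ℝ] (Fin n → ℝ)) : Prop :=
  ∀ x y z : Fin n → ℝ,
    mul (mul x y) z - mul x (mul y z) = mul (mul y x) z - mul y (mul x z)

open scoped Matrix

section Determinant

variable {n : ℕ} {E : Type*} [NormedAddCommGroup E] [NormedSpace ℝ E]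

theorem contDiff_matrix_det {k : WithTop ℕ∞} {M : E → Matrix (Fin n) (Fin n) ℝ}
    (hM : ∀ i j, ContDiff ℝ k fun x => M x i j) : ContDiff ℝ k fun x => (M x).det := by
  simp only [Matrix.det_apply']
  exact ContDiff.sum fun σ _ => contDiff_const.mul (contDiff_prod fun i _ => hM _ _)

/-- Jacobi formula for the derivative of a determinant. -/
theorem fderiv_matrix_det {M : E → Matrix (Fin n) (Fin n) ℝ} {x : E}
    (hM : ∀ i j, DifferentiableAt ℝ (fun x => M x i j) x) (y : E) :
    fderiv ℝ (fun x => (M x).det) x y =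
      ((M x).adjugate * Matrix.of fun i j => fderiv ℝ (fun z => M z i j) x y).trace := by
  let f : ContinuousMultilinearMap ℝ (fun _ : Fin n => Fin n → ℝ) ℝ :=
    { toMultilinearMap := (Matrix.detRowAlternating (R := ℝ) (n := Fin n)).toMultilinearMap
      cont := Continuous.matrix_det (A := fun M : Fin n → Fin n → ℝ => Matrix.of M) continuous_id }
  have hf : HasFDerivAt (fun z => f fun i j => M z i j)
      ((f.linearDeriv fun i j => M x i j).comp
        (ContinuousLinearMap.pi fun i => ContinuousLinearMap.pi fun j =>
          fderiv ℝ (fun z => M z i j) x)) x :=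
    (f.hasFDerivAt _).comp x
      (hasFDerivAt_pi.2 fun i => hasFDerivAt_pi.2 fun j => (hM i j).hasFDerivAt)
  have hf' : HasFDerivAt (fun z => (M z).det) _ x := hf
  rw [hf'.fderiv]
  simp only [ContinuousLinearMap.comp_apply, ContinuousMultilinearMap.linearDeriv_apply]
  have key : ∀ i, (f (Function.update (fun i j => M x i j) i
      fun j => fderiv ℝ (fun z => M z i j) x y)) =
      ∑ j, (M x).adjugate j i * fderiv ℝ (fun z => M z i j) x y := by
    intro i
    have h := Matrix.cramer_transpose_apply (M x) (fun j => fderiv ℝ (fun z => M z i j) x y) i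
    rw [Matrix.cramer_eq_adjugate_mulVec, ← Matrix.adjugate_transpose] at h
    exact h.symm
  refine (Finset.sum_congr rfl fun i _ => key i).trans ?_
  rw [Finset.sum_comm]
  simp [Matrix.trace, Matrix.mul_apply]

end Determinant

section Calculus

variable {E : Type*} [NormedAddCommGroup E] [NormedSpace ℝ E] {P : E → ℝ}

theorem fderiv_fderiv_comm (hP : ContDiff ℝ ⊤ P) (x a b : E) :
    fderiv ℝ (fderiv ℝ P) x a b = fderiv ℝ (fderiv ℝ P) x b a :=
  (hP.contDiffAt.isSymmSndFDerivAt (by simp)).eq a b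

theorem fderiv_fderiv_fderiv_comm (hP : ContDiff ℝ ⊤ P) (x a b : E) :
    fderiv ℝ (fderiv ℝ (fderiv ℝ P)) x a b = fderiv ℝ (fderiv ℝ (fderiv ℝ P)) x b a :=
  ((hP.fderiv_right (m := ⊤) (by simp)).contDiffAt.isSymmSndFDerivAt (by simp)).eq a b

/-- The first derivative of the equation `dP(a + a∗x) = c P`. -/
theorem fderiv_fderiv_affine_field (hP : ContDiff ℝ ⊤ P) {a : E} {L : E →L[ℝ] E} {c : ℝ}
    (h : ∀ x, fderiv ℝ P x (a + L x) = P x * c) (x b : E) :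
    fderiv ℝ (fderiv ℝ P) x b (a + L x) + fderiv ℝ P x (L b) = fderiv ℝ P x b * c := by
  have hP1 : ContDiff ℝ ⊤ (fderiv ℝ P) := hP.fderiv_right (by simp)
  have hd : HasFDerivAt (fun y => fderiv ℝ P y (a + L y)) _ x :=
    (hP1.differentiable (by simp) x).hasFDerivAt.clm_apply (L.hasFDerivAt.const_add a)
  have hr : HasFDerivAt (fun y => P y * c) _ x :=
    (hP.differentiable (by simp) x).hasFDerivAt.mul_const c
  have := congrArg (fun l => l b) ((funext h ▸ hd).unique hr)
  simp only [_root_.add_apply, ContinuousLinearMap.comp_apply,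
    ContinuousLinearMap.flip_apply, _root_.smul_apply, smul_eq_mul] at this
  linarith

/-- The second derivative of the equation `dP(a + a∗x) = c P`. -/
theorem fderiv_fderiv_fderiv_affine_field (hP : ContDiff ℝ ⊤ P) {a : E} {L : E →L[ℝ] E} {c : ℝ}
    (h : ∀ x, fderiv ℝ P x (a + L x) = P x * c) (x b d : E) :
    fderiv ℝ (fderiv ℝ (fderiv ℝ P)) x (a + L x) b d + fderiv ℝ (fderiv ℝ P) x (L b) d
      + fderiv ℝ (fderiv ℝ P) x b (L d) = fderiv ℝ (fderiv ℝ P) x b d * c := by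
  have hP1 : ContDiff ℝ ⊤ (fderiv ℝ P) := hP.fderiv_right (by simp)
  have hP2 : ContDiff ℝ ⊤ (fderiv ℝ (fderiv ℝ P)) := hP1.fderiv_right (by simp)
  have h1 : HasFDerivAt (fderiv ℝ P) _ x := (hP1.differentiable (by simp) x).hasFDerivAt
  have hd : HasFDerivAt (fun y => fderiv ℝ (fderiv ℝ P) y (a + L y) d + fderiv ℝ P y (L d)) _ x :=
    (((hP2.differentiable (by simp) x).hasFDerivAt.clm_apply
      (L.hasFDerivAt.const_add a)).clm_apply (hasFDerivAt_const d x)).add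
      (h1.clm_apply (hasFDerivAt_const (L d) x))
  have hr : HasFDerivAt (fun y => fderiv ℝ P y d * c) _ x :=
    (h1.clm_apply (hasFDerivAt_const d x)).mul_const c
  have he : (fun y => fderiv ℝ (fderiv ℝ P) y (a + L y) d + fderiv ℝ P y (L d)) =
      fun y => fderiv ℝ P y d * c := by
    funext y
    rw [fderiv_fderiv_comm hP]
    exact fderiv_fderiv_affine_field hP h y d
  have := congrArg (fun l => l b) ((he ▸ hd).unique hr)
  simp [-map_add] at this
  have hs := congrArg (fun l => l d) (fderiv_fderiv_fderiv_comm hP x b (a + L x))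
  linarith

theorem fderiv_apply_eq_of_translate (hP : ContDiff ℝ ⊤ P) {v : E} {c : ℝ}
    (h : ∀ x (t : ℝ), P (x + t • v) = P x + c * t) (x : E) : fderiv ℝ P x v = c := by
  have h1 : HasDerivAt (fun t : ℝ => P (x + t • v)) (fderiv ℝ P x v) 0 :=
    (hP.differentiable (by simp) x).hasFDerivAt.hasLineDerivAt v
  have h2 : HasDerivAt (fun t : ℝ => P x + c * t) (c * 1) 0 :=
    ((hasDerivAt_id (0 : ℝ)).const_mul c).const_add _
  rw [← mul_one c]
  exact h1.unique ((funext (h x)).symm ▸ h2)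

theorem fderiv_fderiv_apply_eq_zero (hP : ContDiff ℝ ⊤ P) {v : E} {c : ℝ}
    (h : ∀ x, fderiv ℝ P x v = c) (x b : E) : fderiv ℝ (fderiv ℝ P) x b v = 0 := by
  have hP1 : ContDiff ℝ ⊤ (fderiv ℝ P) := hP.fderiv_right (by simp)
  have h1 : HasFDerivAt (fun y => fderiv ℝ P y v) _ x :=
    (hP1.differentiable (by simp) x).hasFDerivAt.clm_apply (hasFDerivAt_const v x)
  have h2 : HasFDerivAt (fun _ : E => c) (0 : E →L[ℝ] ℝ) x := hasFDerivAt_const c x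
  have := congrArg (fun l => l b) ((funext h ▸ h1).unique h2)
  simpa using this

end Calculus

/-- The matrix of the bilinear form `Hess P + dP ⊗ dP`. -/
noncomputable def expHessian {n : ℕ} (P : (Fin n → ℝ) → ℝ) (x : Fin n → ℝ) :
    Matrix (Fin n) (Fin n) ℝ :=
  Matrix.of fun i j => fderiv ℝ (fderiv ℝ P) x (Pi.single i 1) (Pi.single j 1)
    + fderiv ℝ P x (Pi.single i 1) * fderiv ℝ P x (Pi.single j 1)

section ExpHessian

variable {n : ℕ} {P : (Fin n → ℝ) → ℝ}

theorem sum_mul_apply_single (l : (Fin n → ℝ) →L[ℝ] ℝ) (y : Fin n → ℝ) :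
    ∑ k, y k * l (Pi.single k 1) = l y := by
  conv_rhs => rw [pi_eq_sum_univ' y]
  simp [map_sum]

theorem expHessian_mulVec (x y : Fin n → ℝ) (i : Fin n) :
    (expHessian P x *ᵥ y) i = fderiv ℝ (fderiv ℝ P) x (Pi.single i 1) y
      + fderiv ℝ P x (Pi.single i 1) * fderiv ℝ P x y := by
  rw [← sum_mul_apply_single (fderiv ℝ (fderiv ℝ P) x (Pi.single i 1)) y,
    ← sum_mul_apply_single (fderiv ℝ P x) y, Finset.mul_sum, ← Finset.sum_add_distrib]
  simp only [Matrix.mulVec, dotProduct, expHessian, Matrix.of_apply]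
  exact Finset.sum_congr rfl fun k _ => by ring

theorem expHessian_isSymm (hP : ContDiff ℝ ⊤ P) (x : Fin n → ℝ) : (expHessian P x).IsSymm := by
  ext i j
  simp only [expHessian, Matrix.transpose_apply, Matrix.of_apply]
  rw [fderiv_fderiv_comm hP]
  ring

theorem contDiff_expHessian (hP : ContDiff ℝ ⊤ P) (i j : Fin n) :
    ContDiff ℝ ⊤ fun x => expHessian P x i j := by
  have hP1 : ContDiff ℝ ⊤ (fderiv ℝ P) := hP.fderiv_right (by simp)
  have hP2 : ContDiff ℝ ⊤ (fderiv ℝ (fderiv ℝ P)) := hP1.fderiv_right (by simp)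
  simp only [expHessian, Matrix.of_apply]
  exact ((hP2.clm_apply contDiff_const).clm_apply contDiff_const).add
    ((hP1.clm_apply contDiff_const).mul (hP1.clm_apply contDiff_const))

theorem hessianDet_exp (hP : ContDiff ℝ ⊤ P) (x : Fin n → ℝ) :
    hessianDet (fun y => Real.exp (P y)) x = (expHessian P x).det * Real.exp (n * P x) := by
  have hP1 : ContDiff ℝ ⊤ (fderiv ℝ P) := hP.fderiv_right (by simp)
  have hd : ∀ y, HasFDerivAt (fun y => Real.exp (P y)) (Real.exp (P y) • fderiv ℝ P y) y :=
    fun y => (hP.differentiable (by simp) y).hasFDerivAt.exp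
  have hm : (Matrix.of fun i j : Fin n =>
      fderiv ℝ (fun y => fderiv ℝ (fun y => Real.exp (P y)) y (Pi.single j 1)) x
        (Pi.single i 1)) = Real.exp (P x) • expHessian P x := by
    ext i j
    have he : (fun y => fderiv ℝ (fun y => Real.exp (P y)) y (Pi.single j 1)) =
        fun y => Real.exp (P y) * fderiv ℝ P y (Pi.single j 1) := by
      funext y
      rw [(hd y).fderiv]
      simp
    have h2 : HasFDerivAt (fun y => Real.exp (P y) * fderiv ℝ P y (Pi.single j 1)) _ x :=
      (hd x).mul ((hP1.differentiable (by simp) x).hasFDerivAt.clm_apply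
        (hasFDerivAt_const (Pi.single j 1) x))
    rw [Matrix.of_apply, he, h2.fderiv]
    simp [expHessian]
    ring
  rw [hessianDet, hm, Matrix.det_smul, Fintype.card_fin, Real.exp_nat_mul, mul_comm]

theorem fderiv_expHessian_apply (hP : ContDiff ℝ ⊤ P) (x y : Fin n → ℝ) (i j : Fin n) :
    fderiv ℝ (fun z => expHessian P z i j) x y =
      fderiv ℝ (fderiv ℝ (fderiv ℝ P)) x y (Pi.single i 1) (Pi.single j 1)
        + (fderiv ℝ P x (Pi.single i 1) * fderiv ℝ (fderiv ℝ P) x y (Pi.single j 1)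
          + fderiv ℝ P x (Pi.single j 1) * fderiv ℝ (fderiv ℝ P) x y (Pi.single i 1)) := by
  have hP1 : ContDiff ℝ ⊤ (fderiv ℝ P) := hP.fderiv_right (by simp)
  have hP2 : ContDiff ℝ ⊤ (fderiv ℝ (fderiv ℝ P)) := hP1.fderiv_right (by simp)
  have h1 : HasFDerivAt (fderiv ℝ P) _ x := (hP1.differentiable (by simp) x).hasFDerivAt
  have h2 := (hP2.differentiable (by simp) x).hasFDerivAt
  have h : HasFDerivAt (fun z => expHessian P z i j) _ x :=
    ((h2.clm_apply (hasFDerivAt_const (Pi.single i 1) x)).clm_apply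
      (hasFDerivAt_const (Pi.single j 1) x)).add
      ((h1.clm_apply (hasFDerivAt_const (Pi.single i 1) x)).mul
        (h1.clm_apply (hasFDerivAt_const (Pi.single j 1) x)))
  rw [h.fderiv]
  simp

/-- Infinitesimal relative invariance of `Hess P + dP ⊗ dP`. -/
theorem fderiv_expHessian_affine_field (hP : ContDiff ℝ ⊤ P) {a : Fin n → ℝ}
    {L : (Fin n → ℝ) →L[ℝ] (Fin n → ℝ)} {c : ℝ}
    (h : ∀ x, fderiv ℝ P x (a + L x) = P x * c) (x : Fin n → ℝ) :
    (Matrix.of fun i j => fderiv ℝ (fun z => expHessian P z i j) x (a + L x)) =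
      c • expHessian P x + c • Matrix.vecMulVec (fun i => fderiv ℝ P x (Pi.single i 1))
        (fun i => fderiv ℝ P x (Pi.single i 1))
      - (LinearMap.toMatrix' L.toLinearMap)ᵀ * expHessian P x
      - expHessian P x * LinearMap.toMatrix' L.toLinearMap := by
  have hcol : ∀ i j, (expHessian P x * LinearMap.toMatrix' L.toLinearMap) i j =
      fderiv ℝ (fderiv ℝ P) x (Pi.single i 1) (L (Pi.single j 1))
        + fderiv ℝ P x (Pi.single i 1) * fderiv ℝ P x (L (Pi.single j 1)) := by
    intro i j
    rw [← expHessian_mulVec]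
    simp [Matrix.mul_apply, Matrix.mulVec, dotProduct, LinearMap.toMatrix'_apply]
  ext i j
  have hrow : ((LinearMap.toMatrix' L.toLinearMap)ᵀ * expHessian P x) i j =
      (expHessian P x * LinearMap.toMatrix' L.toLinearMap) j i := by
    rw [← Matrix.transpose_apply (expHessian P x * _), Matrix.transpose_mul,
      (expHessian_isSymm hP x).eq]
  simp only [Matrix.sub_apply, Matrix.add_apply, hrow, hcol, Matrix.smul_apply,
    Matrix.of_apply, fderiv_expHessian_apply hP, Matrix.vecMulVec_apply, smul_eq_mul]
  have h3 := fderiv_fderiv_fderiv_affine_field hP h x (Pi.single i 1) (Pi.single j 1)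
  have hi := fderiv_fderiv_affine_field hP h x (Pi.single i 1)
  have hj := fderiv_fderiv_affine_field hP h x (Pi.single j 1)
  rw [fderiv_fderiv_comm hP] at hi hj
  rw [fderiv_fderiv_comm hP x (L _)] at h3
  rw [eq_sub_of_add_eq hi, eq_sub_of_add_eq hj,
    eq_sub_of_add_eq (eq_sub_of_add_eq h3)]
  simp only [expHessian, Matrix.of_apply]
  ring

theorem expHessian_mulVec_translate (hP : ContDiff ℝ ⊤ P) {v : Fin n → ℝ} {lam : ℝ}
    (hv : ∀ x, fderiv ℝ P x v = lam) (x : Fin n → ℝ) :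
    expHessian P x *ᵥ v = lam • fun i => fderiv ℝ P x (Pi.single i 1) := by
  funext i
  rw [expHessian_mulVec, fderiv_fderiv_apply_eq_zero hP hv, hv]
  simp [mul_comm]

theorem fderiv_det_expHessian_affine_field (hP : ContDiff ℝ ⊤ P) {a : Fin n → ℝ}
    {L : (Fin n → ℝ) →L[ℝ] (Fin n → ℝ)} {c : ℝ}
    (h : ∀ x, fderiv ℝ P x (a + L x) = P x * c)
    (hL : 2 * LinearMap.trace ℝ (Fin n → ℝ) L.toLinearMap = (n + 1) * c)
    {v : Fin n → ℝ} {lam : ℝ} (hlam : lam ≠ 0)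
    (hv : ∀ x, fderiv ℝ P x v = lam) (x : Fin n → ℝ) :
    fderiv ℝ (fun y => (expHessian P y).det) x (a + L x) = 0 := by
  rw [fderiv_matrix_det
    (fun i j => (contDiff_expHessian hP i j).differentiable (by simp) x),
    fderiv_expHessian_affine_field hP h]
  have hadj : (expHessian P x).adjugate *ᵥ (fun i => fderiv ℝ P x (Pi.single i 1)) ⬝ᵥ
      (fun i => fderiv ℝ P x (Pi.single i 1)) = (expHessian P x).det := by
    have h1 := congrArg (fun w => (expHessian P x).adjugate *ᵥ w)
      (expHessian_mulVec_translate hP hv x)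
    simp only [Matrix.mulVec_mulVec, Matrix.adjugate_mul, Matrix.mulVec_smul,
      Matrix.smul_mulVec, Matrix.one_mulVec] at h1
    have h2 := congrArg (fun w => w ⬝ᵥ fun i => fderiv ℝ P x (Pi.single i 1)) h1
    simp only [smul_dotProduct, smul_eq_mul] at h2
    have h3 : v ⬝ᵥ (fun i => fderiv ℝ P x (Pi.single i 1)) = lam := by
      rw [← hv x, ← sum_mul_apply_single]
      rfl
    rw [h3] at h2
    exact mul_left_cancel₀ hlam (by linarith)
  have htr : (LinearMap.toMatrix' L.toLinearMap).trace =
      LinearMap.trace ℝ (Fin n → ℝ) L.toLinearMap :=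
    (LinearMap.trace_eq_matrix_trace ℝ (Pi.basisFun ℝ (Fin n)) _).symm
  have e1 : ((expHessian P x).adjugate *
      ((LinearMap.toMatrix' L.toLinearMap)ᵀ * expHessian P x)).trace =
      (expHessian P x).det * LinearMap.trace ℝ (Fin n → ℝ) L.toLinearMap := by
    rw [Matrix.trace_mul_comm, Matrix.mul_assoc, Matrix.mul_adjugate]
    simp [htr]
  have e2 : ((expHessian P x).adjugate *
      (expHessian P x * LinearMap.toMatrix' L.toLinearMap)).trace =
      (expHessian P x).det * LinearMap.trace ℝ (Fin n → ℝ) L.toLinearMap := by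
    rw [← Matrix.mul_assoc, Matrix.adjugate_mul]
    simp [htr]
  simp only [Matrix.mul_sub, Matrix.mul_add, Matrix.trace_sub, Matrix.trace_add, e1, e2,
    Matrix.mul_smul, Matrix.trace_smul, Matrix.adjugate_mul, Matrix.trace_one, Fintype.card_fin,
    Matrix.mul_vecMulVec, Matrix.trace_vecMulVec, hadj, smul_eq_mul]
  linear_combination (-(expHessian P x).det) * hL

end ExpHessian

section LeftSymmetric

variable {n : ℕ} {mul : (Fin n → ℝ) →ₗ[ℝ] (Fin n → ℝ) →ₗ[ℝ] (Fin n → ℝ)}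

theorem IsLSA.flip_mul (hlsa : IsLSA mul) (a x : Fin n → ℝ) :
    mul.flip (mul a x) =
      mul.flip x * mul.flip a + mul a * mul.flip x - mul.flip x * mul a := by
  refine LinearMap.ext fun z => ?_
  have h := hlsa z a x
  simp only [LinearMap.sub_apply, LinearMap.add_apply, Module.End.mul_apply, LinearMap.flip_apply]
  linear_combination -h

theorem IsLSA.trace_flip_mul (hlsa : IsLSA mul) (a x : Fin n → ℝ) :
    LinearMap.trace ℝ (Fin n → ℝ) (mul.flip (mul a x)) =
      LinearMap.trace ℝ (Fin n → ℝ) (mul.flip x ∘ₗ mul.flip a) := by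
  rw [hlsa.flip_mul, map_sub, map_add, LinearMap.trace_mul_comm ℝ (mul a)]
  simp [Module.End.mul_eq_comp]

/-- The characteristic polynomial `det (id + R(x))` of a multiplication. -/
noncomputable def charDet (mul : (Fin n → ℝ) →ₗ[ℝ] (Fin n → ℝ) →ₗ[ℝ] (Fin n → ℝ))
    (x : Fin n → ℝ) : ℝ :=
  LinearMap.det (LinearMap.id + mul.flip x)

theorem charDet_eq_det (x : Fin n → ℝ) :
    charDet mul x = (1 + LinearMap.toMatrix' (mul.flip x)).det := by
  rw [charDet, ← LinearMap.det_toMatrix', map_add, LinearMap.toMatrix'_id]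

theorem one_add_toMatrix_flip_apply (i j : Fin n) :
    (fun x => (1 + LinearMap.toMatrix' (mul.flip x)) i j) =
      fun x => (1 : Matrix (Fin n) (Fin n) ℝ) i j
        + LinearMap.toContinuousLinearMap (LinearMap.proj i ∘ₗ mul (Pi.single j 1)) x := by
  funext x
  simp [LinearMap.toMatrix'_apply]

theorem hasFDerivAt_toMatrix_flip (x : Fin n → ℝ) (i j : Fin n) :
    HasFDerivAt (fun y => (1 + LinearMap.toMatrix' (mul.flip y)) i j)
      (LinearMap.toContinuousLinearMap (LinearMap.proj i ∘ₗ mul (Pi.single j 1))) x := by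
  rw [one_add_toMatrix_flip_apply]
  exact (ContinuousLinearMap.hasFDerivAt _).const_add _

theorem contDiff_charDet : ContDiff ℝ ⊤ (charDet mul) := by
  rw [funext charDet_eq_det]
  refine contDiff_matrix_det fun i j => ?_
  rw [one_add_toMatrix_flip_apply]
  exact contDiff_const.add (ContinuousLinearMap.contDiff _)

theorem IsLSA.fderiv_charDet (hlsa : IsLSA mul) (a x : Fin n → ℝ) :
    fderiv ℝ (charDet mul) x (a + LinearMap.toContinuousLinearMap (mul a) x) =
      charDet mul x * LinearMap.trace ℝ (Fin n → ℝ) (mul.flip a) := by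
  rw [charDet_eq_det, funext charDet_eq_det,
    fderiv_matrix_det (M := fun y => 1 + LinearMap.toMatrix' (mul.flip y)) fun i j =>
      (hasFDerivAt_toMatrix_flip x i j).differentiableAt]
  have hm : (Matrix.of fun i j => fderiv ℝ (fun y => (1 + LinearMap.toMatrix' (mul.flip y)) i j) x
      (a + LinearMap.toContinuousLinearMap (mul a) x)) =
      LinearMap.toMatrix' (mul.flip (a + mul a x)) := by
    ext i j
    rw [Matrix.of_apply, (hasFDerivAt_toMatrix_flip x i j).fderiv]
    simp [LinearMap.toMatrix'_apply]
  have hb : LinearMap.toMatrix' (mul.flip (a + mul a x)) =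
      (1 + LinearMap.toMatrix' (mul.flip x)) * LinearMap.toMatrix' (mul.flip a)
      + LinearMap.toMatrix' (mul a) * (1 + LinearMap.toMatrix' (mul.flip x))
      - (1 + LinearMap.toMatrix' (mul.flip x)) * LinearMap.toMatrix' (mul a) := by
    rw [map_add, hlsa.flip_mul]
    simp only [map_add, map_sub, LinearMap.toMatrix'_mul]
    noncomm_ring
  have htr : (LinearMap.toMatrix' (mul.flip a)).trace =
      LinearMap.trace ℝ (Fin n → ℝ) (mul.flip a) :=
    (LinearMap.trace_eq_matrix_trace ℝ (Pi.basisFun ℝ (Fin n)) _).symm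
  rw [hm, hb, ← htr]
  generalize 1 + LinearMap.toMatrix' (mul.flip x) = B
  generalize LinearMap.toMatrix' (mul a) = N
  rw [Matrix.mul_sub, Matrix.mul_add, ← Matrix.mul_assoc, ← Matrix.mul_assoc B.adjugate B,
    Matrix.trace_sub, Matrix.trace_add, Matrix.trace_mul_comm B.adjugate (N * B),
    Matrix.mul_assoc N, Matrix.mul_adjugate, Matrix.adjugate_mul]
  simp

theorem charDet_zero : charDet mul 0 = 1 := by
  simp [charDet]

theorem IsLSA.fderiv_charDet_zero (hlsa : IsLSA mul) (a : Fin n → ℝ) :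
    fderiv ℝ (charDet mul) 0 a = LinearMap.trace ℝ (Fin n → ℝ) (mul.flip a) := by
  simpa [charDet_zero] using hlsa.fderiv_charDet a 0

theorem IsLSA.hessian_charDet_zero (hlsa : IsLSA mul) (a b : Fin n → ℝ) :
    fderiv ℝ (fderiv ℝ (charDet mul)) 0 b a =
      LinearMap.trace ℝ (Fin n → ℝ) (mul.flip b) * LinearMap.trace ℝ (Fin n → ℝ) (mul.flip a)
      - LinearMap.trace ℝ (Fin n → ℝ) (mul.flip b ∘ₗ mul.flip a) := by
  have h := fderiv_fderiv_affine_field contDiff_charDet (hlsa.fderiv_charDet a) 0 b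
  rw [hlsa.fderiv_charDet_zero, hlsa.fderiv_charDet_zero] at h
  simp only [map_zero, add_zero, LinearMap.coe_toContinuousLinearMap'] at h
  rw [hlsa.trace_flip_mul] at h
  linarith

theorem IsLSA.det_expHessian_charDet (hlsa : IsLSA mul) {v : Fin n → ℝ} (hv0 : v ≠ 0) {lam : ℝ}
    (hv : ∀ x, fderiv ℝ (charDet mul) x v = lam)
    (htrace : ∀ x : Fin n → ℝ,
      2 * LinearMap.trace ℝ (Fin n → ℝ) (mul x)
        = (n + 1 : ℝ) * LinearMap.trace ℝ (Fin n → ℝ) (mul.flip x)) (x : Fin n → ℝ) :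
    (expHessian (charDet mul) x).det = (expHessian (charDet mul) 0).det := by
  have hP : ContDiff ℝ ⊤ (charDet mul) := contDiff_charDet
  rcases eq_or_ne lam 0 with rfl | hlam
  · have hz : ∀ y, (expHessian (charDet mul) y).det = 0 := fun y =>
      Matrix.exists_mulVec_eq_zero_iff.1
        ⟨v, hv0, by rw [expHessian_mulVec_translate hP hv, zero_smul]⟩
    rw [hz, hz]
  have hD : ContDiff ℝ ⊤ fun y => (expHessian (charDet mul) y).det :=
    contDiff_matrix_det (contDiff_expHessian hP)
  have hzero : ∀ y, charDet mul y ≠ 0 →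
      fderiv ℝ (fun y => (expHessian (charDet mul) y).det) y = 0 := by
    intro y hy
    ext1 w
    have hunit : IsUnit (LinearMap.id + mul.flip y : Module.End ℝ (Fin n → ℝ)) :=
      (LinearMap.isUnit_iff_isUnit_det _).2 (isUnit_iff_ne_zero.2 hy)
    obtain ⟨a, rfl⟩ := ((Module.End.isUnit_iff _).1 hunit).2 w
    exact fderiv_det_expHessian_affine_field hP (hlsa.fderiv_charDet a) (htrace a) hlam hv y
  obtain ⟨ε, hε, hball⟩ := Metric.eventually_nhds_iff_ball.1
    (hP.continuous.continuousAt.eventually_ne (x := 0) (y := 0) (by simp [charDet_zero]))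
  have hloc : (fun y => (expHessian (charDet mul) y).det) =ᶠ[nhds 0]
      fun _ => (expHessian (charDet mul) 0).det := by
    filter_upwards [Metric.ball_mem_nhds (0 : Fin n → ℝ) hε] with y hy
    exact Metric.isOpen_ball.is_const_of_fderiv_eq_zero
      (convex_ball (0 : Fin n → ℝ) ε).isPreconnected
      (hD.differentiable (by simp)).differentiableOn
      (fun z hz => hzero z (hball z hz)) hy (Metric.mem_ball_self hε)
  exact congrFun (AnalyticOnNhd.eq_of_eventuallyEq hD.analyticOnNhd analyticOnNhd_const hloc) x

end LeftSymmetric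

theorem stmt7 (n : ℕ) (hn : 1 ≤ n)
    (mul : (Fin n → ℝ) →ₗ[ℝ] (Fin n → ℝ) →ₗ[ℝ] (Fin n → ℝ))
    (hlsa : IsLSA mul)
    (τ : (Fin n → ℝ) → (Fin n → ℝ) → ℝ)
    (hτ : ∀ x y, τ x y = LinearMap.trace ℝ (Fin n → ℝ) (mul.flip x ∘ₗ mul.flip y))
    (P : (Fin n → ℝ) → ℝ)
    (hP : ∀ x, P x = LinearMap.det (LinearMap.id + mul.flip x))
    (v : Fin n → ℝ) (hv : v ≠ 0) (lam : ℝ)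
    (hhom : ∀ (x : Fin n → ℝ) (t : ℝ), P (x + t • v) = P x + lam * t)
    (htrace : ∀ x : Fin n → ℝ,
      2 * LinearMap.trace ℝ (Fin n → ℝ) (mul x)
        = (n + 1 : ℝ) * LinearMap.trace ℝ (Fin n → ℝ) (mul.flip x)) :
    ∃ κ : ℝ,
      (∀ x : Fin n → ℝ,
        hessianDet (fun y => Real.exp (P y)) x = κ * Real.exp (n * P x)) ∧
      ((∀ x, (∀ y, τ x y = 0) → x = 0) →
        κ ≠ 0 ∧ lam ≠ 0 ∧
        (∀ x : Fin n → ℝ,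
          τ (lam⁻¹ • v) x = LinearMap.trace ℝ (Fin n → ℝ) (mul.flip x)) ∧
        mul (lam⁻¹ • v) (lam⁻¹ • v) = lam⁻¹ • v ∧
        LinearMap.trace ℝ (Fin n → ℝ) (mul.flip (lam⁻¹ • v)) = 1) := by
  obtain rfl : P = charDet mul := funext hP
  have hC : ContDiff ℝ ⊤ (charDet mul) := contDiff_charDet
  have hdv := fderiv_apply_eq_of_translate hC hhom
  refine ⟨(expHessian (charDet mul) 0).det, fun x => ?_, fun hnd => ?_⟩
  · rw [hessianDet_exp hC, hlsa.det_expHessian_charDet hv hdv htrace]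
  have hess : ∀ a b, fderiv ℝ (fderiv ℝ (charDet mul)) 0 b a =
      LinearMap.trace ℝ (Fin n → ℝ) (mul.flip b) * LinearMap.trace ℝ (Fin n → ℝ) (mul.flip a)
      - τ b a := fun a b => by rw [hτ, hlsa.hessian_charDet_zero]
  have htv : LinearMap.trace ℝ (Fin n → ℝ) (mul.flip v) = lam := by
    rw [← hlsa.fderiv_charDet_zero, hdv]
  have hτv : ∀ x, τ v x = lam * LinearMap.trace ℝ (Fin n → ℝ) (mul.flip x) := fun x => by
    have h := fderiv_fderiv_apply_eq_zero hC hdv 0 x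
    rw [fderiv_fderiv_comm hC, hess, htv] at h
    linarith
  have hlam : lam ≠ 0 := by
    rintro rfl
    exact hv (hnd v fun y => by rw [hτv, zero_mul])
  have hτ_sub_smul : ∀ (x y z : Fin n → ℝ) (c : ℝ), τ (x - c • y) z = τ x z - c * τ y z := by
    intro x y z c
    simp [hτ, LinearMap.sub_comp, LinearMap.smul_comp]
  have hτr : ∀ x, τ (lam⁻¹ • v) x = LinearMap.trace ℝ (Fin n → ℝ) (mul.flip x) := fun x => by
    have h : τ (lam⁻¹ • v) x = lam⁻¹ * τ v x := by
      simp [hτ, LinearMap.smul_comp]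
    rw [h, hτv, inv_mul_cancel_left₀ hlam]
  have htr : LinearMap.trace ℝ (Fin n → ℝ) (mul.flip (lam⁻¹ • v)) = 1 := by
    rw [map_smul, map_smul, htv, smul_eq_mul, inv_mul_cancel₀ hlam]
  refine ⟨fun hdet => ?_, hlam, hτr, ?_, htr⟩
  · obtain ⟨w, hw0, hw⟩ := Matrix.exists_mulVec_eq_zero_iff.2 hdet
    have hform : ∀ y, τ w y = 2 * LinearMap.trace ℝ (Fin n → ℝ) (mul.flip w) *
        LinearMap.trace ℝ (Fin n → ℝ) (mul.flip y) := by
      intro y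
      have hlin : fderiv ℝ (fderiv ℝ (charDet mul)) 0 w
          + fderiv ℝ (charDet mul) 0 w • fderiv ℝ (charDet mul) 0 = 0 := by
        refine ContinuousLinearMap.coe_injective (LinearMap.pi_ext' fun i => ?_)
        ext1
        have h := congrFun hw i
        rw [expHessian_mulVec, fderiv_fderiv_comm hC] at h
        simpa [mul_comm] using h
      have h := congrArg (fun l => l y) hlin
      simp only [_root_.add_apply, _root_.smul_apply, _root_.zero_apply, hess,
        smul_eq_mul] at h
      rw [hlsa.fderiv_charDet_zero, hlsa.fderiv_charDet_zero] at h
      linarith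
    have hw' : w = (2 * LinearMap.trace ℝ (Fin n → ℝ) (mul.flip w)) • lam⁻¹ • v :=
      sub_eq_zero.1 (hnd _ fun y => by rw [hτ_sub_smul, hτr, hform, sub_self])
    have ht := congrArg (fun z => LinearMap.trace ℝ (Fin n → ℝ) (mul.flip z)) hw'
    simp only [map_smul mul.flip (2 * _), map_smul (LinearMap.trace ℝ _) (2 * _), htr,
      smul_eq_mul] at ht
    have ht0 : LinearMap.trace ℝ (Fin n → ℝ) (mul.flip w) = 0 := by linarith
    rw [ht0] at hw'
    exact hw0 (by simpa using hw')
  · have hmul : ∀ a x, fderiv ℝ (charDet mul) x (mul a v) =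
        lam * LinearMap.trace ℝ (Fin n → ℝ) (mul.flip a) := by
      intro a x
      have h := fderiv_fderiv_affine_field hC (hlsa.fderiv_charDet a) x v
      rw [fderiv_fderiv_comm hC, fderiv_fderiv_apply_eq_zero hC hdv, hdv, zero_add] at h
      exact h
    have hd0 : ∀ x, fderiv ℝ (charDet mul) x
        (mul (lam⁻¹ • v) (lam⁻¹ • v) - (1 : ℝ) • lam⁻¹ • v) = 0 := by
      intro x
      rw [one_smul, map_sub, map_smul (mul (lam⁻¹ • v)), map_smul, hmul, htr, map_smul, hdv, mul_one,
        sub_self]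
    have h0 := hlsa.fderiv_charDet_zero (mul (lam⁻¹ • v) (lam⁻¹ • v) - (1 : ℝ) • lam⁻¹ • v)
    rw [hd0] at h0
    have := hnd _ fun y => by
      have h := fderiv_fderiv_apply_eq_zero hC hd0 0 y
      rw [fderiv_fderiv_comm hC, hess, ← h0, zero_mul, zero_sub, neg_eq_zero] at h
      exact h
    simpa [sub_eq_zero] using this
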